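/- Define q, r, u₀ : ℤ × ℝ² → ℝ by q(n,t₁,t₂) = 4·6^n·e^{6t₁+14t₂} / ( 6^n·e^{5t₁+13t₂} + 2^n·e^{3t₁+5t₂} + 4·3^n·e^{4t₁+10t₂} ), r(n,t₁,t₂) = ( 3^{n+1}·e^{4t₂} + 2^{n+1}·e^{−t₁−t₂} + e^{−2t₁−4t₂} ) / ( 6^{n+1}·e^{2t₁+8t₂} + 4·3^{n+1}·e^{t₁+5t₂} + 2^{n+1} ), and u₀(n,t₁,t₂) = 2·( 2·72^n·e^{4t₁+16t₂} + 4·18^n·e^{2t₁+10t₂} + 2·24^n·e^{2t₁+8t₂} + 12·54^n·e^{4t₁+18t₂} + 12^n·e^{t₁+5t₂} + 3·108^n·e^{5t₁+21t₂} + 12·36^n·e^{3t₁+13t₂} ) / ( ( 3·6^n·e^{2t₁+8t₂} + 6·3^n·e^{t₁+5t₂} + 2^n )·( 6^n·e^{2t₁+8t₂} + 4·3^n·e^{t₁+5t₂} + 2^n )² ). Then (q, r, u₀) satisfies the t₂-flow of the (1,0,1)-gcdKP hierarchy: for all (n,t₁,t₂), ∂_{t₂}u₀ = q^{[2]}r +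 q^{[1]}r·u₀^{[1]} + q^{[1]}r·u₀ − q·r^{[−2]} − q·r^{[−1]}·u₀ − q·r^{[−1]}·u₀^{[−1]}, ∂_{t₂}q = q^{[2]} + u₀^{[1]}q^{[1]} + u₀q^{[1]} + u₀²q + q^{[1]}r·q + q·r^{[−1]}·q, and ∂_{t₂}r = −r^{[−2]} − u₀^{[−1]}r^{[−1]} − u₀r^{[−1]} − u₀²r − q^{[1]}r² − q·r^{[−1]}·r. -/

import Mathlib

open Real

/-- The solution `q` of the (1,0,1)-gcdKP hierarchy from the paper's Example. -/
noncomputable def qSol (n : ℤ) (t₁ t₂ : ℝ) : ℝ :=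
  4 * (6 : ℝ) ^ n * exp (6 * t₁ + 14 * t₂) /
    ((6 : ℝ) ^ n * exp (5 * t₁ + 13 * t₂) + (2 : ℝ) ^ n * exp (3 * t₁ + 5 * t₂)
      + 4 * (3 : ℝ) ^ n * exp (4 * t₁ + 10 * t₂))

/-- The solution `r` of the (1,0,1)-gcdKP hierarchy from the paper's Example. -/
noncomputable def rSol (n : ℤ) (t₁ t₂ : ℝ) : ℝ :=
  ((3 : ℝ) ^ (n + 1) * exp (4 * t₂) + (2 : ℝ) ^ (n + 1) * exp (-t₁ - t₂)
      + exp (-2 * t₁ - 4 * t₂)) /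
    ((6 : ℝ) ^ (n + 1) * exp (2 * t₁ + 8 * t₂) + 4 * (3 : ℝ) ^ (n + 1) * exp (t₁ + 5 * t₂)
      + (2 : ℝ) ^ (n + 1))

/-- The solution `u₀` of the (1,0,1)-gcdKP hierarchy from the paper's Example. -/
noncomputable def u0Sol (n : ℤ) (t₁ t₂ : ℝ) : ℝ :=
  2 * (2 * (72 : ℝ) ^ n * exp (4 * t₁ + 16 * t₂) + 4 * (18 : ℝ) ^ n * exp (2 * t₁ + 10 * t₂)
      + 2 * (24 : ℝ) ^ n * exp (2 * t₁ + 8 * t₂) + 12 * (54 : ℝ) ^ n * exp (4 * t₁ + 18 * t₂)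
      + (12 : ℝ) ^ n * exp (t₁ + 5 * t₂) + 3 * (108 : ℝ) ^ n * exp (5 * t₁ + 21 * t₂)
      + 12 * (36 : ℝ) ^ n * exp (3 * t₁ + 13 * t₂)) /
    ((3 * (6 : ℝ) ^ n * exp (2 * t₁ + 8 * t₂) + 6 * (3 : ℝ) ^ n * exp (t₁ + 5 * t₂)
        + (2 : ℝ) ^ n)
      * ((6 : ℝ) ^ n * exp (2 * t₁ + 8 * t₂) + 4 * (3 : ℝ) ^ n * exp (t₁ + 5 * t₂)
        + (2 : ℝ) ^ n) ^ 2)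

/-- The mode `(3/2)^n exp (t₁ + 5 t₂)`, the ratio of the second denominator term to the first. -/
noncomputable def modeA (n : ℤ) (t₁ t₂ : ℝ) : ℝ := (3 / 2 : ℝ) ^ n * exp (t₁ + 5 * t₂)

/-- The mode `2^n exp (t₁ + 3 t₂)`, the ratio of the third denominator term to the second. -/
noncomputable def modeG (n : ℤ) (t₁ t₂ : ℝ) : ℝ := (2 : ℝ) ^ n * exp (t₁ + 3 * t₂)

/-- The normalised tau function. -/
def tauF (a g : ℝ) : ℝ := 1 + 4 * a + a * g

lemma modeA_pos (n : ℤ) (t₁ t₂ : ℝ) : 0 < modeA n t₁ t₂ := by unfold modeA; positivity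

lemma modeG_pos (n : ℤ) (t₁ t₂ : ℝ) : 0 < modeG n t₁ t₂ := by unfold modeG; positivity

lemma modeA_add (n k : ℤ) (t₁ t₂ : ℝ) :
    modeA (n + k) t₁ t₂ = (3 / 2 : ℝ) ^ k * modeA n t₁ t₂ := by
  unfold modeA
  rw [zpow_add₀ (by norm_num)]
  ring

lemma modeG_add (n k : ℤ) (t₁ t₂ : ℝ) :
    modeG (n + k) t₁ t₂ = (2 : ℝ) ^ k * modeG n t₁ t₂ := by
  unfold modeG
  rw [zpow_add₀ (by norm_num)]
  ring

lemma hasDerivAt_exp_mul_add (c k t₂ : ℝ) :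
    HasDerivAt (fun s => exp (c + k * s)) (k * exp (c + k * t₂)) t₂ :=
  (((hasDerivAt_id t₂).const_mul k).const_add c).exp.congr_deriv (by simp [mul_comm])

lemma hasDerivAt_modeA (n : ℤ) (t₁ t₂ : ℝ) :
    HasDerivAt (fun s => modeA n t₁ s) (5 * modeA n t₁ t₂) t₂ :=
  ((hasDerivAt_exp_mul_add t₁ 5 t₂).const_mul ((3 / 2 : ℝ) ^ n)).congr_deriv
    (by unfold modeA; ring)

lemma hasDerivAt_modeG (n : ℤ) (t₁ t₂ : ℝ) :
    HasDerivAt (fun s => modeG n t₁ s) (3 * modeG n t₁ t₂) t₂ :=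
  ((hasDerivAt_exp_mul_add t₁ 3 t₂).const_mul ((2 : ℝ) ^ n)).congr_deriv
    (by unfold modeG; ring)

lemma exp_nat_combination (i j : ℕ) (t₁ t₂ : ℝ) :
    exp (i * t₁ + j * t₂) = exp t₁ ^ i * exp t₂ ^ j := by
  rw [exp_add, exp_nat_mul, exp_nat_mul]

lemma qSol_eq (n : ℤ) (t₁ t₂ : ℝ) :
    qSol n t₁ t₂ = 4 * (modeA n t₁ t₂ * modeG n t₁ t₂) * exp (t₁ + t₂)
      / tauF (modeA n t₁ t₂) (modeG n t₁ t₂) := by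
  have h6 : (6 : ℝ) ^ n = 2 ^ n * 3 ^ n := by rw [← mul_zpow]; norm_num
  have e1 := exp_nat_combination 6 14 t₁ t₂
  have e2 := exp_nat_combination 5 13 t₁ t₂
  have e3 := exp_nat_combination 3 5 t₁ t₂
  have e4 := exp_nat_combination 4 10 t₁ t₂
  have e5 := exp_nat_combination 1 5 t₁ t₂
  have e6 := exp_nat_combination 1 3 t₁ t₂
  have e7 := exp_nat_combination 1 1 t₁ t₂
  norm_num at e1 e2 e3 e4 e5 e6 e7
  simp only [qSol, tauF, modeA, modeG, div_zpow, h6, e1, e2, e3, e4, e5, e6, e7]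
  have : (0 : ℝ) < 2 ^ n := by positivity
  have : (0 : ℝ) < 3 ^ n := by positivity
  have := exp_pos t₁
  have := exp_pos t₂
  generalize (2 : ℝ) ^ n = u at *
  generalize (3 : ℝ) ^ n = v at *
  generalize exp t₁ = x at *
  generalize exp t₂ = y at *
  rw [div_eq_div_iff (by positivity) (by positivity)]
  field_simp
  ring

lemma rSol_eq (n : ℤ) (t₁ t₂ : ℝ) :
    rSol n t₁ t₂ = (1 + 2 * modeG n t₁ t₂ + 3 * (modeA n t₁ t₂ * modeG n t₁ t₂))
      / (2 * modeG n t₁ t₂ * exp (t₁ + t₂)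
        * tauF (3 / 2 * modeA n t₁ t₂) (2 * modeG n t₁ t₂)) := by
  have h6 : (6 : ℝ) ^ n = 2 ^ n * 3 ^ n := by rw [← mul_zpow]; norm_num
  have e1 := exp_nat_combination 0 4 t₁ t₂
  have e2 : exp (-t₁ - t₂) = (exp t₁ * exp t₂)⁻¹ := by
    rw [← exp_add, ← exp_neg]; ring_nf
  have e3 : exp (-2 * t₁ - 4 * t₂) = (exp t₁ ^ 2 * exp t₂ ^ 4)⁻¹ := by
    rw [← exp_nat_mul, ← exp_nat_mul, ← exp_add, ← exp_neg]; push_cast; ring_nf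
  have e4 := exp_nat_combination 2 8 t₁ t₂
  have e5 := exp_nat_combination 1 5 t₁ t₂
  have e6 := exp_nat_combination 1 3 t₁ t₂
  have e7 := exp_nat_combination 1 1 t₁ t₂
  norm_num at e1 e4 e5 e6 e7
  simp only [rSol, tauF, modeA, modeG, div_zpow, zpow_add_one₀ (two_ne_zero : (2 : ℝ) ≠ 0),
    zpow_add_one₀ (three_ne_zero : (3 : ℝ) ≠ 0), zpow_add_one₀ (by norm_num : (6 : ℝ) ≠ 0),
    h6, e1, e2, e3, e4, e5, e6, e7]
  have : (0 : ℝ) < 2 ^ n := by positivity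
  have : (0 : ℝ) < 3 ^ n := by positivity
  have := exp_pos t₁
  have := exp_pos t₂
  generalize (2 : ℝ) ^ n = u at *
  generalize (3 : ℝ) ^ n = v at *
  generalize exp t₁ = x at *
  generalize exp t₂ = y at *
  rw [div_eq_div_iff (by positivity) (by positivity)]
  field_simp
  ring

lemma u0Sol_eq (n : ℤ) (t₁ t₂ : ℝ) :
    u0Sol n t₁ t₂ = 2 * (modeA n t₁ t₂ + 2 * (modeA n t₁ t₂ * modeG n t₁ t₂)
        + 3 * (modeA n t₁ t₂ ^ 2 * modeG n t₁ t₂))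
      / (tauF (modeA n t₁ t₂) (modeG n t₁ t₂)
        * tauF (3 / 2 * modeA n t₁ t₂) (2 * modeG n t₁ t₂)) := by
  have h6 : (6 : ℝ) ^ n = 2 ^ n * 3 ^ n := by rw [← mul_zpow]; norm_num
  have h12 : (12 : ℝ) ^ n = (2 ^ n) ^ 2 * 3 ^ n := by
    rw [sq, ← mul_zpow, ← mul_zpow]; norm_num
  have h18 : (18 : ℝ) ^ n = 2 ^ n * (3 ^ n) ^ 2 := by
    rw [sq, ← mul_zpow, ← mul_zpow]; norm_num
  have h24 : (24 : ℝ) ^ n = 2 ^ n * (2 ^ n) ^ 2 * 3 ^ n := by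
    rw [sq, ← mul_zpow, ← mul_zpow, ← mul_zpow]; norm_num
  have h36 : (36 : ℝ) ^ n = (2 ^ n) ^ 2 * (3 ^ n) ^ 2 := by
    rw [sq, sq, ← mul_zpow, ← mul_zpow, ← mul_zpow]; norm_num
  have h54 : (54 : ℝ) ^ n = 2 ^ n * 3 ^ n * (3 ^ n) ^ 2 := by
    rw [sq, ← mul_zpow, ← mul_zpow, ← mul_zpow]; norm_num
  have h72 : (72 : ℝ) ^ n = 2 ^ n * (2 ^ n) ^ 2 * (3 ^ n) ^ 2 := by
    rw [sq, sq, ← mul_zpow, ← mul_zpow, ← mul_zpow, ← mul_zpow]; norm_num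
  have h108 : (108 : ℝ) ^ n = (2 ^ n) ^ 2 * 3 ^ n * (3 ^ n) ^ 2 := by
    rw [sq, sq, ← mul_zpow, ← mul_zpow, ← mul_zpow, ← mul_zpow]; norm_num
  have e1 := exp_nat_combination 4 16 t₁ t₂
  have e2 := exp_nat_combination 2 10 t₁ t₂
  have e3 := exp_nat_combination 2 8 t₁ t₂
  have e4 := exp_nat_combination 4 18 t₁ t₂
  have e5 := exp_nat_combination 1 5 t₁ t₂
  have e6 := exp_nat_combination 5 21 t₁ t₂
  have e7 := exp_nat_combination 3 13 t₁ t₂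
  have e8 := exp_nat_combination 1 3 t₁ t₂
  norm_num at e1 e2 e3 e4 e5 e6 e7 e8
  simp only [u0Sol, tauF, modeA, modeG, div_zpow, h6, h12, h18, h24, h36, h54, h72, h108,
    e1, e2, e3, e4, e5, e6, e7, e8]
  have : (0 : ℝ) < 2 ^ n := by positivity
  have : (0 : ℝ) < 3 ^ n := by positivity
  have := exp_pos t₁
  have := exp_pos t₂
  generalize (2 : ℝ) ^ n = u at *
  generalize (3 : ℝ) ^ n = v at *
  generalize exp t₁ = x at *
  generalize exp t₂ = y at *
  rw [div_eq_div_iff (by positivity) (by positivity)]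
  field_simp
  ring

lemma tauF_pos {a g : ℝ} (ha : 0 < a) (hg : 0 < g) : 0 < tauF a g := by
  unfold tauF; positivity

lemma HasDerivAt.tauF {f h : ℝ → ℝ} {f' h' t : ℝ} (hf : HasDerivAt f f' t)
    (hh : HasDerivAt h h' t) :
    HasDerivAt (fun s => tauF (f s) (h s)) (4 * f' + (f' * h t + f t * h')) t :=
  ((hf.const_mul 4).const_add 1).add (hf.mul hh)

/-- `(q, r, u₀)` satisfies the `t₂`-flow of the (1,0,1)-gcdKP hierarchy. -/
theorem stmt17 (n : ℤ) (t₁ t₂ : ℝ) :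
    HasDerivAt (fun s => u0Sol n t₁ s)
      (qSol (n + 2) t₁ t₂ * rSol n t₁ t₂
        + qSol (n + 1) t₁ t₂ * rSol n t₁ t₂ * u0Sol (n + 1) t₁ t₂
        + qSol (n + 1) t₁ t₂ * rSol n t₁ t₂ * u0Sol n t₁ t₂
        - qSol n t₁ t₂ * rSol (n - 2) t₁ t₂
        - qSol n t₁ t₂ * rSol (n - 1) t₁ t₂ * u0Sol n t₁ t₂
        - qSol n t₁ t₂ * rSol (n - 1) t₁ t₂ * u0Sol (n - 1) t₁ t₂) t₂ ∧
    HasDerivAt (fun s => qSol n t₁ s)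
      (qSol (n + 2) t₁ t₂ + u0Sol (n + 1) t₁ t₂ * qSol (n + 1) t₁ t₂
        + u0Sol n t₁ t₂ * qSol (n + 1) t₁ t₂ + u0Sol n t₁ t₂ ^ 2 * qSol n t₁ t₂
        + qSol (n + 1) t₁ t₂ * rSol n t₁ t₂ * qSol n t₁ t₂
        + qSol n t₁ t₂ * rSol (n - 1) t₁ t₂ * qSol n t₁ t₂) t₂ ∧
    HasDerivAt (fun s => rSol n t₁ s)
      (-rSol (n - 2) t₁ t₂ - u0Sol (n - 1) t₁ t₂ * rSol (n - 1) t₁ t₂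
        - u0Sol n t₁ t₂ * rSol (n - 1) t₁ t₂ - u0Sol n t₁ t₂ ^ 2 * rSol n t₁ t₂
        - qSol (n + 1) t₁ t₂ * rSol n t₁ t₂ ^ 2
        - qSol n t₁ t₂ * rSol (n - 1) t₁ t₂ * rSol n t₁ t₂) t₂ := by
  have hA := hasDerivAt_modeA n t₁ t₂
  have hG := hasDerivAt_modeG n t₁ t₂
  have hE : HasDerivAt (fun s => exp (t₁ + s)) (exp (t₁ + t₂)) t₂ := by
    simpa using hasDerivAt_exp_mul_add t₁ 1 t₂
  have hT := hA.tauF hG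
  have hT' := (hA.const_mul (3 / 2)).tauF (hG.const_mul 2)
  have ha := modeA_pos n t₁ t₂
  have hg := modeG_pos n t₁ t₂
  have he := exp_pos (t₁ + t₂)
  have h0 := tauF_pos ha hg
  have h1 := tauF_pos (mul_pos (by norm_num : (0 : ℝ) < 3 / 2) ha) (mul_pos two_pos hg)
  simp only [qSol_eq, rSol_eq, u0Sol_eq, sub_eq_add_neg n, modeA_add, modeG_add]
  refine ⟨?_, ?_, ?_⟩
  · have hU := (((hA.add ((hA.mul hG).const_mul 2)).add
      (((hA.pow 2).mul hG).const_mul 3)).const_mul 2).div (hT.mul hT')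
      (mul_pos h0 h1).ne'
    refine hU.congr_deriv ?_
    simp only [Pi.mul_apply, Pi.add_apply, Pi.pow_apply]
    generalize modeA n t₁ t₂ = a at *
    generalize modeG n t₁ t₂ = g at *
    generalize exp (t₁ + t₂) = e at *
    norm_num [tauF]
    field_simp
    ring
  · refine HasDerivAt.congr_deriv ((((hA.mul hG).const_mul 4).mul hE).div hT h0.ne') ?_
    simp only [Pi.mul_apply]
    generalize modeA n t₁ t₂ = a at *
    generalize modeG n t₁ t₂ = g at *
    generalize exp (t₁ + t₂) = e at *
    norm_num [tauF]
    field_simp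
    ring
  · refine HasDerivAt.congr_deriv ((((hG.const_mul 2).const_add 1).add
      ((hA.mul hG).const_mul 3)).div (((hG.const_mul 2).mul hE).mul hT')
      (mul_pos (mul_pos (mul_pos two_pos hg) he) h1).ne') ?_
    simp only [Pi.mul_apply, Pi.add_apply]
    generalize modeA n t₁ t₂ = a at *
    generalize modeG n t₁ t₂ = g at *
    generalize exp (t₁ + t₂) = e at *
    norm_num [tauF]
    field_simp
    ring
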